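/- For every real number c > 0 there exists a bounded invertible operator 𝒰 on the Hilbert space H := ℓ²(ℤ,ℂ) ⊕₂ ℓ²(ℤ,ℂ) which is J-unitary for J(x,y) = (y,x), such that: (i) for every closed subspace L ≠ {0} with 𝒰(L) ⊆ L, the spectral radius of the operator induced by 𝒰 on L is strictly greater than c; and (ii) for every closed subspace L' ≠ {0} with 𝒰⁻¹(L') ⊆ L', the spectral radius of the operator induced by 𝒰⁻¹ on L' is strictly greater than c. -/

import Mathlib

noncomputable section
open ContinuousLinearMap
open scoped ENNReal

/-- The Hilbert space `ℓ²(ℤ, ℂ)` of square-summable two-sided complex sequences. -/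
abbrev l2 : Type := lp (fun _ : ℤ => ℂ) 2

/-- The Hilbert direct sum `ℓ²(ℤ,ℂ) ⊕₂ ℓ²(ℤ,ℂ)`. -/
abbrev Hl : Type := WithLp 2 (l2 × l2)

/-- The continuous linear equivalence between `Hl` and `l2 × l2`. -/
def e : Hl ≃L[ℂ] l2 × l2 := WithLp.prodContinuousLinearEquiv 2 ℂ l2 l2

/-- The operator `J : (x, y) ↦ (y, x)` on `ℓ²(ℤ,ℂ) ⊕₂ ℓ²(ℤ,ℂ)`. -/
def Jop : Hl →L[ℂ] Hl :=
  ((e.symm : l2 × l2 →L[ℂ] Hl).comp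
    ((ContinuousLinearMap.snd ℂ l2 l2).prod (ContinuousLinearMap.fst ℂ l2 l2))).comp
    (e : Hl →L[ℂ] l2 × l2)

/-- The restriction of a continuous linear map to an invariant submodule. -/
def restrictOp {H : Type*} [NormedAddCommGroup H] [InnerProductSpace ℂ H]
    (T : H →L[ℂ] H) (L : Submodule ℂ H) (hL : ∀ x ∈ L, T x ∈ L) : L →L[ℂ] L :=
  { toLinearMap := (T : H →ₗ[ℂ] H).restrict hL
    cont := Continuous.subtype_mk (T.continuous.comp continuous_subtype_val) _ }

open Filter Topology
open scoped NNReal InnerProductSpace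

/-! ### Spectral radius lower bounds -/

/-- If the orbit of a vector `v` under `T` infinitely often exceeds `R ^ n * ‖v‖`, then the spectral
radius of `T` is at least `R`. -/
theorem le_spectralRadius_of_frequently_lt {F : Type*} [NormedAddCommGroup F] [NormedSpace ℂ F]
    [CompleteSpace F] (T : F →L[ℂ] F) {R : ℝ} (hR : 0 ≤ R) (v : F)
    (h : ∃ᶠ n : ℕ in atTop, R ^ n * ‖v‖ < ‖(T ^ n) v‖) :
    ENNReal.ofReal R ≤ spectralRadius ℂ T := by
  by_contra! hlt
  have hev := (spectrum.pow_nnnorm_pow_one_div_tendsto_nhds_spectralRadius T).eventually_lt_const hlt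
  refine h ((hev.and (eventually_gt_atTop 0)).mono ?_)
  rintro n ⟨hn, hn0⟩
  have hn0' : (0 : ℝ) < n := by exact_mod_cast hn0
  have h1 : (‖T ^ n‖₊ : ℝ≥0∞) ≤ (ENNReal.ofReal R) ^ n := by
    have := ENNReal.rpow_le_rpow hn.le hn0'.le
    rwa [← ENNReal.rpow_mul, one_div_mul_cancel hn0'.ne', ENNReal.rpow_one,
      ENNReal.rpow_natCast] at this
  have h2 : ‖T ^ n‖ ≤ R ^ n := by
    rw [← ENNReal.ofReal_pow hR] at h1
    have := ENNReal.toReal_mono ENNReal.ofReal_ne_top h1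
    rwa [ENNReal.toReal_ofReal (pow_nonneg hR n)] at this
  exact not_lt.mpr (((T ^ n).le_opNorm v).trans
    (mul_le_mul_of_nonneg_right h2 (norm_nonneg v)))

theorem coe_restrictOp_pow_apply {H : Type*} [NormedAddCommGroup H] [InnerProductSpace ℂ H]
    (T : H →L[ℂ] H) (L : Submodule ℂ H) (hL : ∀ x ∈ L, T x ∈ L) (n : ℕ) (v : L) :
    (((restrictOp T L hL) ^ n) v : H) = (T ^ n) (v : H) := by
  induction n with
  | zero => rfl
  | succ n ih =>
    rw [pow_succ', pow_succ', mul_apply_eq_comp, mul_apply_eq_comp, ← ih]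
    rfl

theorem lt_spectralRadius_restrictOp {T : Hl →L[ℂ] Hl} {c R : ℝ} (hc : 0 ≤ c) (hcR : c < R)
    (hT : ∀ v : Hl, v ≠ 0 → ∃ᶠ n : ℕ in atTop, R ^ n * ‖v‖ < ‖(T ^ n) v‖)
    (L : Submodule ℂ Hl) (hcl : IsClosed (L : Set Hl)) (hne : L ≠ ⊥) (hL : ∀ x ∈ L, T x ∈ L) :
    ENNReal.ofReal c < spectralRadius ℂ (restrictOp T L hL) := by
  obtain ⟨v, hv, hv0⟩ := L.ne_bot_iff.mp hne
  have : CompleteSpace L := hcl.completeSpace_coe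
  refine ((ENNReal.ofReal_lt_ofReal_iff (hc.trans_lt hcR)).mpr hcR).trans_le
    (le_spectralRadius_of_frequently_lt _ (hc.trans hcR.le) ⟨v, hv⟩ ((hT v hv0).mono ?_))
  intro n hn
  rwa [← coe_restrictOp_pow_apply T L hL n ⟨v, hv⟩] at hn

/-! ### Weighted shifts with prescribed potential -/

section Shift

variable {s : ℤ → ℝ} {C : ℝ≥0}

theorem sub_le_of_lipschitzWith (hs : LipschitzWith C s) (d i : ℤ) :
    s i - s (i - d) ≤ C * |(d : ℝ)| := by
  have h := hs.dist_le_mul i (i - d)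
  rw [Real.dist_eq, Int.dist_eq] at h
  push_cast at h
  rw [sub_sub_cancel] at h
  exact (le_abs_self _).trans h

theorem summable_mul_norm_sq_sub (a : ℝ) (d : ℤ) (x : l2) :
    Summable fun i : ℤ => a * ‖x (i - d)‖ ^ 2 := by
  have h : Summable fun i : ℤ => ‖x i‖ ^ 2 := by
    have := (lp.memℓp x).summable (by norm_num)
    simpa using this
  exact ((Equiv.subRight d).summable_iff.mpr h).mul_left _

theorem norm_sq_weightedShift_le (hs : LipschitzWith C s) (d : ℤ) (x : l2) (i : ℤ) :
    ‖(Real.exp (s i - s (i - d)) : ℂ) * x (i - d)‖ ^ 2 ≤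
      (Real.exp (C * |(d : ℝ)|)) ^ 2 * ‖x (i - d)‖ ^ 2 := by
  rw [norm_mul, mul_pow, Complex.norm_real, Real.norm_of_nonneg (Real.exp_pos _).le]
  gcongr
  exact sub_le_of_lipschitzWith hs d i

theorem memℓp_weightedShift (hs : LipschitzWith C s) (d : ℤ) (x : l2) :
    Memℓp (fun i : ℤ => (Real.exp (s i - s (i - d)) : ℂ) * x (i - d)) 2 := by
  refine memℓp_gen ?_
  have := Summable.of_nonneg_of_le (fun i => sq_nonneg _) (norm_sq_weightedShift_le hs d x)
    (summable_mul_norm_sq_sub _ d x)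
  simpa using this

/-- The weighted shift by `d` on `ℓ²(ℤ, ℂ)` with potential `s`: it sends the basis vector `δ_k` to
`exp (s (k + d) - s k) δ_{k + d}`. -/
def weightedShift (hs : LipschitzWith C s) (d : ℤ) : l2 →L[ℂ] l2 :=
  LinearMap.mkContinuous
    { toFun := fun x => ⟨fun i => (Real.exp (s i - s (i - d)) : ℂ) * x (i - d),
        memℓp_weightedShift hs d x⟩
      map_add' := fun x y => by
        ext i
        exact mul_add _ _ _
      map_smul' := fun a x => by
        ext i
        exact mul_left_comm _ _ _ }
    (Real.exp (C * |(d : ℝ)|)) fun x => by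
      refine (sq_le_sq₀ (norm_nonneg _) (by positivity)).mp ?_
      have hn : ∀ y : l2, ‖y‖ ^ 2 = ∑' i, ‖y i‖ ^ 2 := fun y => by
        have := lp.norm_rpow_eq_tsum (p := 2) (by norm_num) y
        simpa using this
      rw [mul_pow, hn, hn x, ← (Equiv.subRight d).tsum_eq fun i => ‖x i‖ ^ 2, ← tsum_mul_left]
      have hsum := summable_mul_norm_sq_sub (Real.exp (C * |(d : ℝ)|) ^ 2) d x
      exact (Summable.of_nonneg_of_le (fun i => sq_nonneg _) (norm_sq_weightedShift_le hs d x)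
        hsum).tsum_le_tsum (norm_sq_weightedShift_le hs d x) hsum

@[simp]
theorem weightedShift_apply (hs : LipschitzWith C s) (d : ℤ) (x : l2) (i : ℤ) :
    weightedShift hs d x i = (Real.exp (s i - s (i - d)) : ℂ) * x (i - d) := rfl

theorem weightedShift_weightedShift (hs : LipschitzWith C s) (d d' : ℤ) (x : l2) :
    weightedShift hs d (weightedShift hs d' x) = weightedShift hs (d + d') x := by
  ext i
  rw [weightedShift_apply, weightedShift_apply, weightedShift_apply, ← mul_assoc,
    ← Complex.ofReal_mul, ← Real.exp_add, sub_add_sub_cancel, sub_sub]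

theorem weightedShift_zero (hs : LipschitzWith C s) (x : l2) : weightedShift hs 0 x = x := by
  ext i
  simp

theorem inner_weightedShift {s' : ℤ → ℝ} {C' : ℝ≥0} (hs : LipschitzWith C s)
    (hs' : LipschitzWith C' s') (hss : ∀ i, s' i = -s i) (d : ℤ) (x y : l2) :
    ⟪weightedShift hs d x, weightedShift hs' d y⟫_ℂ = ⟪x, y⟫_ℂ := by
  rw [lp.inner_eq_tsum, lp.inner_eq_tsum, ← (Equiv.subRight d).tsum_eq fun i => ⟪x i, y i⟫_ℂ]
  refine tsum_congr fun i => ?_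
  have h : (Real.exp (s i - s (i - d)) : ℂ) * (Real.exp (s' i - s' (i - d)) : ℂ) = 1 := by
    rw [← Complex.ofReal_mul, ← Real.exp_add, hss, hss]
    simp
  simp only [weightedShift_apply, RCLike.inner_apply, map_mul, Complex.conj_ofReal,
    Equiv.subRight_apply]
  linear_combination (y (i - d) * (starRingEnd ℂ) (x (i - d))) * h

theorem frequently_lt_norm_weightedShift (hs : LipschitzWith C s) {R : ℝ} (hR : 0 < R) (d : ℤ)
    (hgrow : ∀ (k : ℤ) (b : ℝ), ∃ᶠ n : ℕ in atTop, b + Real.log R * n < s (k + n * d))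
    {x : l2} (hx : x ≠ 0) (M : ℝ) :
    ∃ᶠ n : ℕ in atTop, R ^ n * M < ‖weightedShift hs (n * d) x‖ := by
  obtain ⟨k, hk⟩ : ∃ k, x k ≠ 0 := by
    by_contra! h
    exact hx (by ext i; exact h i)
  have hk' : 0 < ‖x k‖ := norm_pos_iff.mpr hk
  refine (hgrow k (s k + M / ‖x k‖)).mono fun n hn => ?_
  have h1 : R ^ n = Real.exp (Real.log R * n) := by
    rw [mul_comm, Real.exp_nat_mul, Real.exp_log hR]
  have h2 : M < Real.exp (M / ‖x k‖) * ‖x k‖ := by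
    rw [← div_lt_iff₀ hk']
    linarith [Real.add_one_le_exp (M / ‖x k‖)]
  have h3 : R ^ n * M < Real.exp (s (k + n * d) - s k) * ‖x k‖ :=
    calc R ^ n * M < R ^ n * (Real.exp (M / ‖x k‖) * ‖x k‖) := by gcongr
      _ = Real.exp (Real.log R * n + M / ‖x k‖) * ‖x k‖ := by rw [h1, Real.exp_add, mul_assoc]
      _ ≤ _ := by gcongr; linarith
  refine h3.trans_le ?_
  have h4 := lp.norm_apply_le_norm two_ne_zero (weightedShift hs (n * d) x) (k + n * d)
  rwa [weightedShift_apply, norm_mul, Complex.norm_real, Real.norm_of_nonneg (Real.exp_pos _).le,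
    add_sub_cancel_right] at h4

end Shift

/-! ### The oscillating potential -/

theorem abs_mul_sin_log_sub_le {x y : ℝ} (hx : 0 < x) (hy : 0 < y) :
    |x * Real.sin (Real.log x) - y * Real.sin (Real.log y)| ≤ 2 * |x - y| := by
  wlog hxy : x ≤ y generalizing x y
  · rw [abs_sub_comm, abs_sub_comm x]
    exact this hy hx (le_of_not_ge hxy)
  have hlog : Real.log y - Real.log x ≤ y / x - 1 := by
    rw [← Real.log_div hy.ne' hx.ne']
    exact Real.log_le_sub_one_of_pos (by positivity)
  have hmono := Real.log_le_log hx hxy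
  have hsin : |Real.sin (Real.log x) - Real.sin (Real.log y)| ≤ y / x - 1 := by
    refine (Real.abs_sin_sub_sin_le _ _).trans ?_
    rw [abs_sub_comm, abs_of_nonneg (by linarith)]
    exact hlog
  have h1 : x * |Real.sin (Real.log x) - Real.sin (Real.log y)| ≤ y - x := by
    calc _ ≤ x * (y / x - 1) := by gcongr
      _ = y - x := by field_simp
  have h2 : |(x - y) * Real.sin (Real.log y)| ≤ |x - y| := by
    rw [abs_mul]
    exact mul_le_of_le_one_right (abs_nonneg _) (Real.abs_sin_le_one _)
  calc _ = |x * (Real.sin (Real.log x) - Real.sin (Real.log y)) +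
        (x - y) * Real.sin (Real.log y)| := by ring_nf
    _ ≤ |x * (Real.sin (Real.log x) - Real.sin (Real.log y))| +
        |(x - y) * Real.sin (Real.log y)| := abs_add_le _ _
    _ ≤ (y - x) + |x - y| := by
        rw [abs_mul, abs_of_pos hx]
        gcongr
    _ = 2 * |x - y| := by
        rw [abs_sub_comm, abs_of_nonneg (by linarith)]
        ring

/-- A Lipschitz potential on `ℤ` whose slope from the origin oscillates between `-K` and `K`. -/
def oscPotential (K : ℝ) (i : ℤ) : ℝ :=
  K * ((|(i : ℝ)| + 1) * Real.sin (Real.log (|(i : ℝ)| + 1)))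

theorem lipschitzWith_oscPotential (K : ℝ) : LipschitzWith (‖K‖₊ * 2) (oscPotential K) := by
  refine LipschitzWith.of_dist_le_mul fun i j => ?_
  have h := abs_mul_sin_log_sub_le (x := |(i : ℝ)| + 1) (y := |(j : ℝ)| + 1)
    (by positivity) (by positivity)
  rw [add_sub_add_right_eq_sub] at h
  have h' := abs_abs_sub_abs_le (i : ℝ) j
  rw [Real.dist_eq, Int.dist_eq, oscPotential, oscPotential, ← mul_sub, abs_mul]
  push_cast
  rw [Real.norm_eq_abs, mul_assoc]
  gcongr
  linarith

theorem oscPotential_neg (K : ℝ) (i : ℤ) : oscPotential (-K) i = -oscPotential K i :=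
  neg_mul _ _

theorem exists_phase_mul_sin_eq_abs (K : ℝ) :
    ∃ θ : ℝ, ∀ j : ℕ, K * Real.sin (θ + j * (2 * Real.pi)) = |K| := by
  rcases le_total 0 K with h | h
  · exact ⟨Real.pi / 2, fun j => by simp [Real.sin_add_nat_mul_two_pi, abs_of_nonneg h]⟩
  · exact ⟨-(Real.pi / 2), fun j => by simp [Real.sin_add_nat_mul_two_pi, abs_of_nonpos h]⟩

theorem frequently_lt_oscPotential {K r : ℝ} (hK : r < |K|) {d : ℤ} (hd : |d| = 1) (k : ℤ)
    (b : ℝ) : ∃ᶠ n : ℕ in atTop, b + r * n < oscPotential K (k + n * d) := by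
  obtain ⟨θ, hθ⟩ := exists_phase_mul_sin_eq_abs K
  set x : ℕ → ℝ := fun j => Real.exp (θ + j * (2 * Real.pi)) with hx
  have hxt : Tendsto x atTop atTop := Real.tendsto_exp_atTop.comp
    (tendsto_atTop_add_const_left _ _
      (tendsto_natCast_atTop_atTop.atTop_mul_const Real.two_pi_pos))
  have hnt : Tendsto (fun j => ⌈x j⌉₊) atTop atTop := tendsto_nat_ceil_atTop.comp hxt
  set B : ℝ := |(k : ℝ)| + 2
  have hlin : ∀ᶠ n : ℕ in atTop, b + |K| * (1 + 2 * B) < (|K| - r) * n :=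
    (tendsto_natCast_atTop_atTop.const_mul_atTop (sub_pos.mpr hK)).eventually_gt_atTop _
  refine hnt.frequently (Eventually.frequently ((hnt.eventually hlin).mono fun j hj => ?_))
  set n := ⌈x j⌉₊
  have hxpos : 0 < x j := Real.exp_pos _
  have hn1 : x j ≤ n := Nat.le_ceil _
  have hn2 : (n : ℝ) < x j + 1 := Nat.ceil_lt_add_one hxpos.le
  set y : ℝ := |((k + n * d : ℤ) : ℝ)| + 1 with hy
  have hdR : |(d : ℝ)| = 1 := by exact_mod_cast hd
  have hnd : |(n : ℝ) * d| = n := by rw [abs_mul, hdR, mul_one, Nat.abs_cast]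
  have hyx : |y - x j| ≤ B := by
    have h1 := abs_abs_sub_abs_le ((k : ℝ) + n * d) (n * d)
    rw [add_sub_cancel_right, hnd] at h1
    rw [hy]
    push_cast
    rw [abs_le] at h1 ⊢
    constructor <;> simp only [B] <;> linarith [h1.1, h1.2, abs_nonneg (k : ℝ)]
  have hlip := (abs_mul_sin_log_sub_le (x := y) (by positivity) hxpos).trans
    (mul_le_mul_of_nonneg_left hyx zero_le_two)
  have hmul : |K * (y * Real.sin (Real.log y)) - |K| * x j| ≤ |K| * (2 * B) := by
    have : |K| * x j = K * (x j * Real.sin (Real.log (x j))) := by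
      rw [hx, Real.log_exp, ← hθ j]
      ring
    rw [this, ← mul_sub, abs_mul]
    gcongr
  have hKn : |K| * (n : ℝ) ≤ |K| * (x j + 1) := by gcongr
  rw [oscPotential, ← hy]
  linarith [(abs_le.mp hmul).1]

/-! ### The operator -/

/-- The direct sum of the weighted shifts by `d` with potentials `oscPotential K` and
`oscPotential (-K)`. -/
def oscShift (K : ℝ) (d : ℤ) : Hl →L[ℂ] Hl :=
  ((e.symm : l2 × l2 →L[ℂ] Hl).comp
    ((weightedShift (lipschitzWith_oscPotential K) d).prodMap
      (weightedShift (lipschitzWith_oscPotential (-K)) d))).comp (e : Hl →L[ℂ] l2 × l2)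

theorem oscShift_apply (K : ℝ) (d : ℤ) (v : Hl) :
    oscShift K d v = WithLp.toLp 2 (weightedShift (lipschitzWith_oscPotential K) d v.fst,
      weightedShift (lipschitzWith_oscPotential (-K)) d v.snd) := rfl

theorem Jop_apply (v : Hl) : Jop v = WithLp.toLp 2 (v.snd, v.fst) := rfl

theorem oscShift_mul (K : ℝ) (d d' : ℤ) : oscShift K d * oscShift K d' = oscShift K (d + d') := by
  ext1 v
  simp only [mul_apply_eq_comp, oscShift_apply, WithLp.toLp_fst, WithLp.toLp_snd,
    weightedShift_weightedShift]

theorem oscShift_zero (K : ℝ) : oscShift K 0 = 1 := by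
  ext1 v
  rw [oscShift_apply, weightedShift_zero, weightedShift_zero]
  rfl

theorem oscShift_pow (K : ℝ) (d : ℤ) (n : ℕ) : oscShift K d ^ n = oscShift K (n * d) := by
  induction n with
  | zero => simp [oscShift_zero]
  | succ n ih => rw [pow_succ, ih, oscShift_mul]; push_cast; rw [add_mul, one_mul]

theorem adjoint_oscShift_comp_Jop (K : ℝ) (d : ℤ) :
    (adjoint (oscShift K d)).comp (Jop.comp (oscShift K d)) = Jop := by
  ext1 v
  refine ext_inner_left ℂ fun u => ?_
  simp only [ContinuousLinearMap.comp_apply, ContinuousLinearMap.adjoint_inner_right, Jop_apply,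
    oscShift_apply, WithLp.prod_inner_apply]
  congr 1
  · exact inner_weightedShift _ _ (oscPotential_neg K) d _ _
  · exact inner_weightedShift _ _ (fun i => by rw [oscPotential_neg, neg_neg]) d _ _

theorem oscShift_comp_Jop_adjoint (K : ℝ) (d : ℤ) :
    (oscShift K d).comp (Jop.comp (adjoint (oscShift K d))) = Jop := by
  have hJ : Jop * Jop = 1 := rfl
  have h : adjoint (oscShift K d) * (Jop * oscShift K d) = Jop := adjoint_oscShift_comp_Jop K d
  have hinv : oscShift K d * oscShift K (-d) = 1 := by
    rw [oscShift_mul, add_neg_cancel, oscShift_zero]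
  have hadj : Jop * adjoint (oscShift K d) = oscShift K (-d) * Jop := by
    calc _ = Jop * (adjoint (oscShift K d) * (Jop * (oscShift K d * oscShift K (-d)) * Jop)) := by
          rw [hinv, mul_one, hJ, mul_one]
      _ = Jop * (adjoint (oscShift K d) * (Jop * oscShift K d)) * oscShift K (-d) * Jop := by
          simp only [mul_assoc]
      _ = _ := by rw [h, hJ, one_mul]
  change oscShift K d * (Jop * adjoint (oscShift K d)) = Jop
  rw [hadj, ← mul_assoc, hinv, one_mul]

theorem frequently_lt_norm_oscShift_pow {K R : ℝ} (hR : 0 < R) (hK : Real.log R < |K|) {d : ℤ}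
    (hd : |d| = 1) (v : Hl) (hv : v ≠ 0) :
    ∃ᶠ n : ℕ in atTop, R ^ n * ‖v‖ < ‖(oscShift K d ^ n) v‖ := by
  have hfs : v.fst ≠ 0 ∨ v.snd ≠ 0 := by
    by_contra! h
    exact hv (WithLp.ofLp_injective 2 (Prod.ext h.1 h.2))
  rcases hfs with h | h
  · refine (frequently_lt_norm_weightedShift (lipschitzWith_oscPotential K) hR d
      (frequently_lt_oscPotential hK hd) h ‖v‖).mono fun n hn => hn.trans_le ?_
    rw [oscShift_pow]
    exact WithLp.norm_fst_le _ (oscShift K (n * d) v)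
  · refine (frequently_lt_norm_weightedShift (lipschitzWith_oscPotential (-K)) hR d
      (frequently_lt_oscPotential ((abs_neg K).symm ▸ hK) hd) h ‖v‖).mono
      fun n hn => hn.trans_le ?_
    rw [oscShift_pow]
    exact WithLp.norm_snd_le _ (oscShift K (n * d) v)

/-- For every `c > 0` there is a bounded invertible `J`-unitary operator `𝒰` on
`ℓ²(ℤ,ℂ) ⊕₂ ℓ²(ℤ,ℂ)` such that on every nonzero closed invariant subspace of `𝒰`
(resp. of `𝒰⁻¹`) the induced operator has spectral radius strictly greater than `c`. -/
theorem stmt7 (c : ℝ) (hc : 0 < c) :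
    ∃ U Uinv : Hl →L[ℂ] Hl,
      U.comp Uinv = 1 ∧ Uinv.comp U = 1 ∧
      (adjoint U).comp (Jop.comp U) = Jop ∧
      U.comp (Jop.comp (adjoint U)) = Jop ∧
      (∀ L : Submodule ℂ Hl, IsClosed (L : Set Hl) → L ≠ ⊥ →
        ∀ hL : ∀ x ∈ L, U x ∈ L,
          ENNReal.ofReal c < spectralRadius ℂ (restrictOp U L hL)) ∧
      (∀ L' : Submodule ℂ Hl, IsClosed (L' : Set Hl) → L' ≠ ⊥ →
        ∀ hL' : ∀ x ∈ L', Uinv x ∈ L',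
          ENNReal.ofReal c < spectralRadius ℂ (restrictOp Uinv L' hL')) := by
  have hR : 0 < c + 1 := by linarith
  set K : ℝ := |Real.log (c + 1)| + 1
  have hK : Real.log (c + 1) < |K| :=
    (le_abs_self _).trans_lt ((lt_add_one _).trans_le (le_abs_self K))
  refine ⟨oscShift K 1, oscShift K (-1), ?_, ?_, adjoint_oscShift_comp_Jop K 1,
    oscShift_comp_Jop_adjoint K 1, ?_, ?_⟩
  · exact (oscShift_mul K 1 (-1)).trans (oscShift_zero K)
  · exact (oscShift_mul K (-1) 1).trans (oscShift_zero K)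
  · exact lt_spectralRadius_restrictOp hc.le (lt_add_one c)
      (frequently_lt_norm_oscShift_pow hR hK (by norm_num))
  · exact lt_spectralRadius_restrictOp hc.le (lt_add_one c)
      (frequently_lt_norm_oscShift_pow hR hK (by norm_num))
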